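/- arXiv:1803.11176 — 10 statements merged into one kernel-verified Lean document; each statement's English description precedes it below -/
import Mathlib

section
/- Let n ≥ 2 be an integer and k ∈ {1, ..., n-1}. Let a_1, ..., a_n and b_1, ..., b_{n-k} be positive real numbers satisfying max_{1≤i≤n} a_i ≤ min_{1≤j≤n-k} b_j and ∑_{i=1}^{n} a_i = ∑_{j=1}^{n-k} b_j. Then ∑_{i=1}^{n} a_i^2 < ∑_{j=1}^{n-k} b_j^2 (strict inequality). -/
/-- A refined reversed Cauchy–Bunyakovsky–Schwarz inequality: if `n ≥ 2`,
`1 ≤ k ≤ n - 1`, the positive reals `a_1, …, a_n` and `b_1, …, b_{n-k}` satisfy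
`max a_i ≤ min b_j` and have equal sums, then `∑ a_i² < ∑ b_j²`. -/
theorem reversed_CBS_refined (n k : ℕ) (hn : 2 ≤ n) (hk1 : 1 ≤ k) (hk2 : k ≤ n - 1)
    (a : Fin n → ℝ) (b : Fin (n - k) → ℝ)
    (ha : ∀ i, 0 < a i) (hb : ∀ j, 0 < b j)
    (hab : ∀ i j, a i ≤ b j)
    (hsum : ∑ i, a i = ∑ j, b j) :
    ∑ i, (a i) ^ 2 < ∑ j, (b j) ^ 2 := by
  have hpos : 0 < n - k := by omega
  haveI : Nonempty (Fin (n - k)) := ⟨⟨0, hpos⟩⟩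
  obtain ⟨j0, hj0⟩ := Finite.exists_min b
  have hm := hb j0
  have e1 : ∑ i, b j0 * a i = ∑ j, b j0 * b j := by
    rw [← Finset.mul_sum, ← Finset.mul_sum, hsum]
  have hA : ∀ i, a i ^ 2 ≤ b j0 * a i := fun i => by nlinarith [ha i, hab i j0]
  have hB : ∀ j, b j0 * b j ≤ b j ^ 2 := fun j => by nlinarith [hb j, hj0 j]
  by_cases h : ∃ i, a i < b j0
  · obtain ⟨i, hi⟩ := h
    have h1 : ∑ i, a i ^ 2 < ∑ i, b j0 * a i :=
      Finset.sum_lt_sum (fun i _ => hA i) ⟨i, Finset.mem_univ _, by nlinarith [ha i]⟩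
    have h2 : ∑ j, b j0 * b j ≤ ∑ j, b j ^ 2 := Finset.sum_le_sum fun j _ => hB j
    linarith
  · push Not at h
    have h1 : ∑ i, a i ^ 2 ≤ ∑ i, b j0 * a i := Finset.sum_le_sum fun i _ => hA i
    have hlt : ∑ _j : Fin (n - k), b j0 < ∑ j, b j := by
      have h3 : ∑ _i : Fin n, b j0 ≤ ∑ i, a i := Finset.sum_le_sum fun i _ => h i
      have h4 : ((n - k : ℕ) : ℝ) < n := by exact_mod_cast (by omega : n - k < n)
      simp only [Finset.sum_const, Finset.card_univ, Fintype.card_fin, nsmul_eq_mul] at h3 ⊢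
      nlinarith
    obtain ⟨j, -, hj⟩ := Finset.exists_lt_of_sum_lt hlt
    have h2 : ∑ j, b j0 * b j < ∑ j, b j ^ 2 :=
      Finset.sum_lt_sum (fun j _ => hB j) ⟨j, Finset.mem_univ _, by nlinarith [hb j]⟩
    linarith
end

section
/- Suppose f ∈ C^3([0,1]) satisfies f ≥ 0, f' ≥ 0, f'' ≥ 0 and f''' ≥ 0 on [0,1]. Then for any integer N ≥ 1: 0 ≤ ∑_{i=0}^{N} f(i/N) − N·∫_0^1 f(t) dt − (f(0)+f(1))/2 ≤ (f'(1) − f'(0))/(4N). -/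
lemma integral_affine_aux (a b p q : ℝ) :
    ∫ x in a..b, (p + q * x) = p * (b - a) + q * (b ^ 2 - a ^ 2) / 2 := by
  rw [intervalIntegral.integral_add (by simp) (by apply Continuous.intervalIntegrable; fun_prop)]
  rw [intervalIntegral.integral_const_mul, integral_id, intervalIntegral.integral_const]
  simp only [smul_eq_mul]
  ring

lemma cell_aux (f g : ℝ → ℝ) (hc : ConvexOn ℝ (Set.Icc 0 1) f)
    (hcont : ContinuousOn f (Set.Icc 0 1))
    (hg : ∀ x ∈ Set.Icc (0 : ℝ) 1, HasDerivWithinAt f (g x) (Set.Icc 0 1) x)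
    (a b : ℝ) (ha : 0 ≤ a) (hab : a < b) (hb : b ≤ 1) :
    ∫ x in a..b, f x ≤ (b - a) * (f a + f b) / 2 ∧
    (b - a) * (f a + f b) / 2 - (b - a) ^ 2 * (g b - g a) / 4 ≤ ∫ x in a..b, f x := by
  have hsub : Set.Icc a b ⊆ Set.Icc 0 1 := Set.Icc_subset_Icc ha hb
  have hint : IntervalIntegrable f MeasureTheory.volume a b := by
    apply ContinuousOn.intervalIntegrable
    rw [Set.uIcc_of_le hab.le]
    exact hcont.mono hsub
  have hlin : ∀ p q : ℝ, IntervalIntegrable (fun x => p + q * x) MeasureTheory.volume a b :=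
    fun p q => by apply Continuous.intervalIntegrable; fun_prop
  have haI : a ∈ Set.Icc (0 : ℝ) 1 := hsub ⟨le_refl _, hab.le⟩
  have hbI : b ∈ Set.Icc (0 : ℝ) 1 := hsub ⟨hab.le, le_refl _⟩
  have hba : 0 < b - a := sub_pos.2 hab
  constructor
  · have h := intervalIntegral.integral_mono_on hab.le hint
      (hlin ((b * f a - a * f b) / (b - a)) ((f b - f a) / (b - a))) (fun x hx => by
        have h := hc.2 haI hbI
          (show 0 ≤ (b - x) / (b - a) from div_nonneg (by linarith [hx.2]) hba.le)
          (show 0 ≤ (x - a) / (b - a) from div_nonneg (by linarith [hx.1]) hba.le)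
          (by field_simp; ring)
        simp only [smul_eq_mul] at h
        have e : (b - x) / (b - a) * a + (x - a) / (b - a) * b = x := by
          field_simp; ring
        rw [e] at h
        refine h.trans (le_of_eq ?_)
        field_simp; ring)
    rw [integral_affine_aux] at h
    refine h.trans (le_of_eq ?_)
    field_simp; ring
  · have h := intervalIntegral.integral_mono_on hab.le
      (hlin ((f a - g a * a + f b - g b * b) / 2) ((g a + g b) / 2)) hint (fun x hx => by
        have hxI := hsub hx
        have t1 : f a + g a * (x - a) ≤ f x := by
          rcases hx.1.eq_or_lt with h | h
          · subst h; simp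
          · have := hc.le_slope_of_hasDerivWithinAt haI hxI h (hg a haI)
            rw [slope_def_field, le_div_iff₀ (sub_pos.2 h)] at this
            linarith
        have t2 : f b + g b * (x - b) ≤ f x := by
          rcases hx.2.eq_or_lt with h | h
          · subst h; simp
          · have := hc.slope_le_of_hasDerivWithinAt hxI hbI h (hg b hbI)
            rw [slope_def_field, div_le_iff₀ (sub_pos.2 h)] at this
            linarith
        linarith)
    rw [integral_affine_aux] at h
    refine le_trans (le_of_eq ?_) h
    ring

/-- If `f ∈ C³([0,1])` with `f, f', f'', f''' ≥ 0` on `[0,1]`, then for every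
integer `N ≥ 1`:
`0 ≤ ∑_{i=0}^{N} f(i/N) − N·∫_0^1 f − (f(0)+f(1))/2 ≤ (f'(1) − f'(0))/(4N)`. -/
theorem sum_sub_integral_bounds (f : ℝ → ℝ)
    (hf : ContDiffOn ℝ 3 f (Set.Icc 0 1))
    (h0 : ∀ x ∈ Set.Icc (0 : ℝ) 1, 0 ≤ f x)
    (h1 : ∀ x ∈ Set.Icc (0 : ℝ) 1, 0 ≤ iteratedDerivWithin 1 f (Set.Icc 0 1) x)
    (h2 : ∀ x ∈ Set.Icc (0 : ℝ) 1, 0 ≤ iteratedDerivWithin 2 f (Set.Icc 0 1) x)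
    (h3 : ∀ x ∈ Set.Icc (0 : ℝ) 1, 0 ≤ iteratedDerivWithin 3 f (Set.Icc 0 1) x)
    (N : ℕ) (hN : 1 ≤ N) :
    0 ≤ (∑ i ∈ Finset.range (N + 1), f (i / N)) - N * (∫ t in (0 : ℝ)..1, f t)
        - (f 0 + f 1) / 2 ∧
    (∑ i ∈ Finset.range (N + 1), f (i / N)) - N * (∫ t in (0 : ℝ)..1, f t)
        - (f 0 + f 1) / 2
      ≤ (iteratedDerivWithin 1 f (Set.Icc 0 1) 1
          - iteratedDerivWithin 1 f (Set.Icc 0 1) 0) / (4 * N) := by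
  set g := iteratedDerivWithin 1 f (Set.Icc 0 1) with hgdef
  have hu : UniqueDiffOn ℝ (Set.Icc (0 : ℝ) 1) := uniqueDiffOn_Icc zero_lt_one
  have hcont := hf.continuousOn
  have hg : ∀ x ∈ Set.Icc (0 : ℝ) 1, HasDerivWithinAt f (g x) (Set.Icc 0 1) x := by
    intro x hx
    rw [hgdef, iteratedDerivWithin_one]
    exact (hf.differentiableOn (by norm_num) x hx).hasDerivWithinAt
  have hg2 : ∀ x ∈ Set.Icc (0 : ℝ) 1,
      HasDerivWithinAt g (iteratedDerivWithin 2 f (Set.Icc 0 1) x) (Set.Icc 0 1) x := by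
    intro x hx
    rw [iteratedDerivWithin_succ]
    exact (hf.differentiableOn_iteratedDerivWithin (m := 1) (by norm_num) hu x hx).hasDerivWithinAt
  have hc : ConvexOn ℝ (Set.Icc 0 1) f :=
    convexOn_of_hasDerivWithinAt2_nonneg (convex_Icc 0 1) hcont
      (fun x hx => (hg x (interior_subset hx)).mono interior_subset)
      (fun x hx => (hg2 x (interior_subset hx)).mono interior_subset)
      (fun x hx => h2 x (interior_subset hx))
  have hNpos : (0 : ℝ) < N := by exact_mod_cast hN
  have hii : ∀ a b : ℝ, a ∈ Set.Icc (0 : ℝ) 1 → b ∈ Set.Icc (0 : ℝ) 1 →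
      IntervalIntegrable f MeasureTheory.volume a b := fun a b ha hb =>
    (hcont.mono (Set.ordConnected_Icc.uIcc_subset ha hb)).intervalIntegrable
  have key : ∀ n : ℕ, n ≤ N →
      0 ≤ (∑ i ∈ Finset.range (n + 1), f (i / N)) - N * (∫ t in (0 : ℝ)..(n / N), f t)
        - (f 0 + f (n / N)) / 2 ∧
      (∑ i ∈ Finset.range (n + 1), f (i / N)) - N * (∫ t in (0 : ℝ)..(n / N), f t)
        - (f 0 + f (n / N)) / 2 ≤ (g (n / N) - g 0) / (4 * N) := by
    intro n
    induction n with
    | zero => intro _; simp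
    | succ n ih =>
      intro hn
      obtain ⟨i1, i2⟩ := ih (by omega)
      have hn' : (n : ℝ) + 1 ≤ N := by exact_mod_cast hn
      have ha : (0 : ℝ) ≤ n / N := by positivity
      have hb : ((n + 1 : ℕ) : ℝ) / N ≤ 1 := by
        rw [div_le_one hNpos]; exact_mod_cast hn
      have hd : ((n + 1 : ℕ) : ℝ) / N - n / N = 1 / N := by push_cast; ring
      have hp : (0 : ℝ) < 1 / N := by positivity
      have hab : (n : ℝ) / N < ((n + 1 : ℕ) : ℝ) / N := by linarith
      obtain ⟨c1, c2⟩ := cell_aux f g hc hcont hg _ _ ha hab hb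
      rw [Finset.sum_range_succ, ← intervalIntegral.integral_add_adjacent_intervals
        (hii 0 (n / N) (by simp) ⟨ha, by linarith⟩)
        (hii (n / N) ((n + 1 : ℕ) / N) ⟨ha, by linarith⟩ ⟨by linarith, hb⟩)]
      rw [hd] at c1 c2
      generalize ((n + 1 : ℕ) : ℝ) / N = b at *
      generalize (n : ℝ) / N = a at *
      generalize (∫ x in a..b, f x) = I at *
      have d1 := mul_le_mul_of_nonneg_left c1 hNpos.le
      have d2 := mul_le_mul_of_nonneg_left c2 hNpos.le
      have e1 : (N : ℝ) * (1 / N * (f a + f b) / 2) = (f a + f b) / 2 := by field_simp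
      have e2 : (N : ℝ) * (1 / N * (f a + f b) / 2 - (1 / N) ^ 2 * (g b - g a) / 4)
          = (f a + f b) / 2 - (g b - g a) / (4 * N) := by field_simp
      have e3 : (g b - g 0) / (4 * N) = (g b - g a) / (4 * N) + (g a - g 0) / (4 * N) := by ring
      rw [e1] at d1
      rw [e2] at d2
      rw [e3, mul_add]
      constructor <;> linarith
  have := key N le_rfl
  rwa [div_self hNpos.ne'] at this
end

section
/- For integers n ≥ 2 and k ∈ {0, ..., n-1}, there exists x_{n,k} ∈ [(k-1)/(n-1), k/(n-1)] such that φ_{n,k}(x) > 0 for all x ∈ [0, x_{n,k}) ∩ [0, (n-1)/(2n-k-2)) and φ_{n,k}(x) < 0 for all x ∈ (x_{n,k}, (n-1)/(2n-k-2)). -/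
/-- The function `φ_{n,k}` from Lemma 3 of the paper. -/
noncomputable def phi (n k : ℕ) (x : ℝ) : ℝ :=
  (∑ i ∈ Finset.range n, 1 / (1 - (i / ((n : ℝ) - 1)) * x))
    - ∑ i ∈ Finset.range (n - k), 1 / (1 - x - (i / ((n : ℝ) - 1)) * x)

/-- Reduced form of `phi`. -/
noncomputable def redP (m p : ℕ) (y : ℝ) : ℝ :=
  (∑ j ∈ Finset.range m, 1 / (1 - (j : ℝ) * y))
    - ∑ i ∈ Finset.range p, 1 / (1 - ((m : ℝ) + 1 + i) * y)

lemma phi_eq_redP (m p k : ℕ) (hm : 1 ≤ m) (h : m = p + k) (x : ℝ) :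
    phi (m + 1) k x = redP m p (x / m) := by
  have hm0 : (m : ℝ) ≠ 0 := by positivity
  have e : m + 1 - k = p + 1 := by omega
  unfold phi redP
  rw [e, Finset.sum_range_succ, Finset.sum_range_succ']
  push_cast
  have e1 : ∀ j : ℕ, (1 : ℝ) - (j / ((m : ℝ) + 1 - 1)) * x = 1 - j * (x / m) := by
    intro j; rw [add_sub_cancel_right]; field_simp
  have e2 : ∀ i : ℕ, (1 : ℝ) - x - ((i + 1 : ℝ) / ((m : ℝ) + 1 - 1)) * x
      = 1 - ((m : ℝ) + 1 + i) * (x / m) := by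
    intro j; rw [add_sub_cancel_right]; field_simp; ring
  simp only [e1, e2]
  have e3 : (1 : ℝ) - m * (x / m) = 1 - x := by field_simp
  rw [e3]
  simp

lemma sum_upper (N : ℕ) (w : ℝ) (h : (N : ℝ) < w) :
    ∑ j ∈ Finset.range N, 1 / (w - j) ≤ Real.log w - Real.log (w - N) := by
  induction N with
  | zero => simp
  | succ N ih =>
    push_cast at h ⊢
    rw [Finset.sum_range_succ]
    have h1 := ih (by linarith)
    have ha : 0 < w - N := by linarith
    have hb : 0 < w - (N + 1) := by linarith
    have h2 := Real.one_sub_inv_le_log_of_pos (div_pos ha hb)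
    rw [Real.log_div ha.ne' hb.ne', inv_div] at h2
    have h3 : 1 - (w - (N + 1)) / (w - N) = 1 / (w - N) := by field_simp; ring
    linarith

lemma sum_lower (N : ℕ) (w : ℝ) (h : (N : ℝ) < w + 1) :
    Real.log (w + 1) - Real.log (w + 1 - N) ≤ ∑ j ∈ Finset.range N, 1 / (w - j) := by
  induction N with
  | zero => simp
  | succ N ih =>
    push_cast at h ⊢
    rw [Finset.sum_range_succ]
    have h1 := ih (by linarith)
    have ha : 0 < w - N := by linarith
    have hb : 0 < w + 1 - N := by linarith
    have h2 := Real.log_le_sub_one_of_pos (div_pos hb ha)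
    rw [Real.log_div hb.ne' ha.ne'] at h2
    have h3 : (w + 1 - N) / (w - N) - 1 = 1 / (w - N) := by field_simp; ring
    have h4 : w + 1 - (N + 1 : ℝ) = w - N := by ring
    rw [h4]
    linarith

lemma redP_inv (m p : ℕ) (v : ℝ) (hv : 0 < v) :
    redP m p (1 / v) = v * ((∑ j ∈ Finset.range m, 1 / (v - j))
      - ∑ i ∈ Finset.range p, 1 / ((v - m - 1) - i)) := by
  unfold redP
  rw [mul_sub, Finset.mul_sum, Finset.mul_sum]
  congr 1
  · refine Finset.sum_congr rfl fun j _ => ?_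
    rw [show (1 : ℝ) - j * (1 / v) = (v - j) / v by field_simp, one_div_div]; ring
  · refine Finset.sum_congr rfl fun j _ => ?_
    rw [show (1 : ℝ) - ((m : ℝ) + 1 + j) * (1 / v) = (v - m - 1 - j) / v by field_simp; ring,
      one_div_div]; ring

lemma redP_right (m p k : ℕ) (hk : 1 ≤ k) (hp : 1 ≤ p) (h : m = p + k) :
    redP m p ((k : ℝ) / m ^ 2) ≤ 0 := by
  have hk' : (0 : ℝ) < k := by positivity
  have hp' : (0 : ℝ) < p := by positivity
  have hm' : (m : ℝ) = p + k := by exact_mod_cast h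
  have hm0 : (0 : ℝ) < m := by linarith
  have hv : (0 : ℝ) < (m : ℝ) ^ 2 / k := by positivity
  rw [show (k : ℝ) / m ^ 2 = 1 / ((m : ℝ) ^ 2 / k) by field_simp, redP_inv _ _ _ hv]
  have e1 : (m : ℝ) ^ 2 / k - m = m * p / k := by
    field_simp; rw [hm']; ring
  have e2 : (m : ℝ) * p / k - p = p ^ 2 / k := by
    field_simp; rw [hm']; ring
  have p1 : (0 : ℝ) < m * p / k := by positivity
  have p2 : (0 : ℝ) < (p : ℝ) ^ 2 / k := by positivity
  have u := sum_upper m ((m : ℝ) ^ 2 / k) (by linarith)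
  have l := sum_lower p ((m : ℝ) ^ 2 / k - m - 1) (by linarith)
  rw [sub_add_cancel, e1, e2] at l
  rw [e1] at u
  have e3 : Real.log ((m : ℝ) ^ 2 / k) + Real.log ((p : ℝ) ^ 2 / k)
      = Real.log (m * p / k) + Real.log (m * p / k) := by
    rw [← Real.log_mul hv.ne' p2.ne', ← Real.log_mul p1.ne' p1.ne']
    congr 1; field_simp
  rw [e1]
  refine mul_nonpos_of_nonneg_of_nonpos hv.le ?_
  linarith

lemma redP_left (m p c : ℕ) (hp : 1 ≤ p) (h : m = p + 1 + c) :
    0 ≤ redP m p ((c : ℝ) / m ^ 2) := by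
  rcases Nat.eq_zero_or_pos c with rfl | hc
  · simp [redP, h]
  have hk' : (0 : ℝ) < c := by positivity
  have hp' : (1 : ℝ) ≤ p := by exact_mod_cast hp
  have hm' : (m : ℝ) = p + 1 + c := by exact_mod_cast h
  have hm0 : (0 : ℝ) < m := by linarith
  have hv : (0 : ℝ) < (m : ℝ) ^ 2 / c := by positivity
  rw [show (c : ℝ) / m ^ 2 = 1 / ((m : ℝ) ^ 2 / c) by field_simp, redP_inv _ _ _ hv]
  have e1 : (m : ℝ) ^ 2 / c - m = m * (p + 1) / c := by
    field_simp; rw [hm']; ring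
  have e2 : (m : ℝ) * (p + 1) / c - (p + 1) = (p + 1) ^ 2 / c := by
    field_simp; rw [hm']; ring
  have p2 : (0 : ℝ) < ((p : ℝ) + 1) ^ 2 / c := by positivity
  obtain ⟨v, hvd⟩ : ∃ v, v = (m : ℝ) ^ 2 / c := ⟨_, rfl⟩
  obtain ⟨u, hud⟩ : ∃ u, u = (m : ℝ) * (p + 1) / c := ⟨_, rfl⟩
  have hcu : c * u = m * (p + 1) := by rw [hud]; field_simp
  rw [← hvd] at e1 hv ⊢
  rw [← hud] at e1 e2
  have l := sum_lower m v (by linarith)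
  have up := sum_upper p (v - m - 1) (by linarith)
  refine mul_nonneg hv.le ?_
  have a1 : 0 < v + 1 := by linarith
  have a2 : 0 < v + 1 - m := by linarith
  have a3 : 0 < v - m - 1 := by linarith
  have a4 : 0 < v - m - 1 - p := by linarith
  have key : Real.log (v - m - 1) + Real.log (v + 1 - m)
      ≤ Real.log (v + 1) + Real.log (v - m - 1 - p) := by
    rw [← Real.log_mul a3.ne' a2.ne', ← Real.log_mul a1.ne' a4.ne']
    apply Real.log_le_log (by positivity)
    have : v = u + m := by linarith
    rw [this]
    have hc' : (c : ℝ) = m - (p + 1) := by linarith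
    rw [hc'] at hcu
    nlinarith
  linarith

lemma weighted_anti (m p : ℕ) (hm : 1 ≤ m) (y z : ℝ) (hy : 0 ≤ y) (hyz : y < z)
    (hz : ((m : ℝ) + p) * z < 1) :
    (1 - m * z) * redP m p z < (1 - m * y) * redP m p y := by
  have hz0 : 0 < z := by linarith
  have pos : ∀ a t : ℝ, a ≤ m + p → 0 ≤ t → t ≤ z → 0 < 1 - a * t := by
    intro a t ha ht htz
    have : a * t ≤ (m + p) * t := by gcongr
    have : ((m : ℝ) + p) * t ≤ (m + p) * z := by gcongr
    linarith
  have hp0 : (0 : ℝ) ≤ p := by positivity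
  unfold redP
  rw [mul_sub, mul_sub, Finset.mul_sum, Finset.mul_sum, Finset.mul_sum, Finset.mul_sum]
  have sub_aux : ∀ a b c d : ℝ, a < b → d ≤ c → a - c < b - d := fun a b c d h1 h2 => by linarith
  apply sub_aux
  · apply Finset.sum_lt_sum_of_nonempty
    · simp; omega
    · intro j hj
      have hj : (j : ℝ) < m := by exact_mod_cast Finset.mem_range.1 hj
      have h1 := pos j z (by linarith) hz0.le le_rfl
      have h2 := pos j y (by linarith) hy hyz.le
      rw [mul_one_div, mul_one_div, div_lt_div_iff₀ h1 h2]
      nlinarith [mul_pos (sub_pos.2 hj) (sub_pos.2 hyz)]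
  · apply Finset.sum_le_sum
    intro j hj
    have hj : (j : ℝ) + 1 ≤ p := by exact_mod_cast Finset.mem_range.1 hj
    have hj0 : (0 : ℝ) ≤ j := by positivity
    have h1 := pos (m + 1 + j) z (by linarith) hz0.le le_rfl
    have h2 := pos (m + 1 + j) y (by linarith) hy hyz.le
    rw [mul_one_div, mul_one_div, div_le_div_iff₀ h2 h1]
    nlinarith [mul_nonneg (add_nonneg hj0 zero_le_one) (sub_pos.2 hyz).le]

lemma redP_cont (m p : ℕ) (a b : ℝ) (ha : 0 ≤ a) (hb : ((m : ℝ) + p) * b < 1) :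
    ContinuousOn (redP m p) (Set.Icc a b) := by
  have pos : ∀ c t : ℝ, c ≤ m + p → t ∈ Set.Icc a b → 1 - c * t ≠ 0 := by
    intro c t hc ht
    have h0 : 0 ≤ t := ha.trans ht.1
    have : c * t ≤ (m + p) * t := by gcongr
    have : ((m : ℝ) + p) * t ≤ (m + p) * b := by gcongr; exact ht.2
    linarith
  have hp0 : (0 : ℝ) ≤ p := by positivity
  unfold redP
  apply ContinuousOn.sub
  · refine continuousOn_finsetSum _ fun j hj => ?_
    have hj : (j : ℝ) < m := by exact_mod_cast Finset.mem_range.1 hj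
    exact continuousOn_const.div (by fun_prop) fun t ht => pos _ t (by linarith) ht
  · refine continuousOn_finsetSum _ fun j hj => ?_
    have hj : (j : ℝ) + 1 ≤ p := by exact_mod_cast Finset.mem_range.1 hj
    exact continuousOn_const.div (by fun_prop) fun t ht => pos _ t (by linarith) ht

/-- Existence of a root in the reduced variable when `p ≥ 1`. -/
lemma redP_root (m p k : ℕ) (hp : 1 ≤ p) (h : m = p + k) :
    ∃ y, 0 ≤ y ∧ ((k : ℝ) - 1) / m ^ 2 ≤ y ∧ y ≤ (k : ℝ) / m ^ 2 ∧ redP m p y = 0 := by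
  rcases Nat.eq_zero_or_pos k with rfl | hk
  · refine ⟨0, le_rfl, ?_, by simp, by simp [redP, h]⟩
    apply div_nonpos_of_nonpos_of_nonneg <;> simp
  obtain ⟨c, rfl⟩ : ∃ c, k = c + 1 := ⟨k - 1, by omega⟩
  have hm' : (m : ℝ) = p + (c + 1) := by exact_mod_cast h
  have hp' : (1 : ℝ) ≤ p := by exact_mod_cast hp
  have hc0 : (0 : ℝ) ≤ c := by positivity
  have hm0 : (0 : ℝ) < m := by linarith
  have hl := redP_left m p c hp (by omega)
  have hr := redP_right m p (c + 1) hk hp h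
  have ha : (0 : ℝ) ≤ (c : ℝ) / m ^ 2 := by positivity
  have hb : ((m : ℝ) + p) * (((c + 1 : ℕ) : ℝ) / m ^ 2) < 1 := by
    rw [← mul_div_assoc, div_lt_one (by positivity)]
    push_cast
    rw [hm']
    nlinarith
  have hab : (c : ℝ) / m ^ 2 ≤ ((c + 1 : ℕ) : ℝ) / m ^ 2 := by
    push_cast; gcongr; linarith
  obtain ⟨y, hy, hy0⟩ := intermediate_value_Icc' hab (redP_cont m p _ _ ha hb) ⟨hr, hl⟩
  refine ⟨y, ha.trans hy.1, ?_, hy.2, hy0⟩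
  push_cast
  rw [add_sub_cancel_right]
  exact hy.1

/-- For integers `n ≥ 2` and `0 ≤ k ≤ n - 1`, there exists
`x_{n,k} ∈ [(k-1)/(n-1), k/(n-1)]` such that `φ_{n,k}` is positive on
`[0, x_{n,k}) ∩ [0, (n-1)/(2n-k-2))` and negative on `(x_{n,k}, (n-1)/(2n-k-2))`. -/
theorem phi_sign_change (n k : ℕ) (hn : 2 ≤ n) (hk : k ≤ n - 1) :
    ∃ x₀ ∈ Set.Icc (((k : ℝ) - 1) / ((n : ℝ) - 1)) ((k : ℝ) / ((n : ℝ) - 1)),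
      (∀ x : ℝ, 0 ≤ x → x < x₀ →
          x < ((n : ℝ) - 1) / (2 * (n : ℝ) - (k : ℝ) - 2) → 0 < phi n k x) ∧
      (∀ x : ℝ, x₀ < x →
          x < ((n : ℝ) - 1) / (2 * (n : ℝ) - (k : ℝ) - 2) → phi n k x < 0) := by
  obtain ⟨m, rfl⟩ : ∃ m, n = m + 1 := ⟨n - 1, by omega⟩
  obtain ⟨p, hp⟩ : ∃ p, m = p + k := ⟨m - k, by omega⟩
  have hm : 1 ≤ m := by omega
  have hm' : (m : ℝ) = p + k := by exact_mod_cast hp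
  have hm0 : (0 : ℝ) < m := by positivity
  have hp0 : (0 : ℝ) ≤ p := by positivity
  have dom : ∀ x : ℝ, x < (((m + 1 : ℕ) : ℝ) - 1) / (2 * ((m + 1 : ℕ) : ℝ) - (k : ℝ) - 2) →
      ((m : ℝ) + p) * (x / m) < 1 := by
    intro x hx
    push_cast at hx
    rw [show (m : ℝ) + 1 - 1 = m by ring,
      show 2 * ((m : ℝ) + 1) - k - 2 = m + p by linarith, lt_div_iff₀ (by linarith)] at hx
    rw [← mul_div_assoc, div_lt_one hm0]
    linarith
  simp only [phi_eq_redP m p k hm hp]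
  rcases Nat.eq_zero_or_pos p with rfl | hp1
  · refine ⟨k / m, ⟨?_, ?_⟩, ?_, ?_⟩
    · push_cast; rw [add_sub_cancel_right]; gcongr; linarith
    · push_cast; rw [add_sub_cancel_right]
    · intro x hx _ hd
      have hd := dom x hd
      simp only [Nat.cast_zero, add_zero] at hd
      unfold redP
      simp only [Finset.range_zero, Finset.sum_empty, sub_zero]
      apply Finset.sum_pos
      · intro j hj
        have hj : (j : ℝ) < m := by exact_mod_cast Finset.mem_range.1 hj
        have h0 : 0 ≤ x / m := by positivity
        have : j * (x / m) ≤ m * (x / m) := by gcongr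
        apply one_div_pos.2
        linarith
      · simp; omega
    · intro x hx hd
      have hd := dom x hd
      have : (k : ℝ) = m := by simpa using hm'.symm
      rw [this, div_self hm0.ne'] at hx
      simp only [Nat.cast_zero, add_zero] at hd
      rw [mul_div_cancel₀ _ hm0.ne'] at hd
      linarith
  · obtain ⟨y, hy, hy1, hy2, hy0⟩ := redP_root m p k hp1 hp
    have wpos : ∀ z : ℝ, 0 ≤ z → ((m : ℝ) + p) * z < 1 → 0 < 1 - m * z := by
      intro z hz h
      nlinarith [mul_nonneg hp0 hz]
    have e : ∀ a : ℝ, a / (((m + 1 : ℕ) : ℝ) - 1) = a / m ^ 2 * m := by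
      intro a; push_cast; rw [add_sub_cancel_right]; field_simp
    have hdy : ((m : ℝ) + p) * y < 1 := by
      have : ((m : ℝ) + p) * y ≤ (m + p) * (k / m ^ 2) := by gcongr
      refine this.trans_lt ?_
      rw [← mul_div_assoc, div_lt_one (by positivity), hm']
      have : (0 : ℝ) < p := by positivity
      nlinarith
    refine ⟨y * m, ⟨?_, ?_⟩, ?_, ?_⟩
    · rw [e]; gcongr
    · rw [e]; gcongr
    · intro x hx hxy hd
      have h := weighted_anti m p hm (x / m) y (by positivity) ((div_lt_iff₀ hm0).2 hxy) hdy
      rw [hy0, mul_zero] at h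
      exact (pos_iff_pos_of_mul_pos h).1 (wpos _ (by positivity) (dom x hd))
    · intro x hxy hd
      have hlt : y < x / m := (lt_div_iff₀ hm0).2 hxy
      have h := weighted_anti m p hm y (x / m) hy hlt (dom x hd)
      rw [hy0, mul_zero] at h
      have := wpos _ (hy.trans hlt.le) (dom x hd)
      by_contra hc
      push Not at hc
      linarith [mul_nonneg this.le hc]
end

section
/- Let n > 2 be an integer, k ∈ {1, ..., n-2}, and x ∈ (0, (n-1)/(2n-k-2)). If ∑_{i=0}^{n-1} 1/(1 − (i/(n-1))x) = ∑_{j=0}^{n-k-1} 1/(1 − x − (j/(n-1))x), then ∑_{i=0}^{n-1} 1/(1 − (i/(n-1))x)^2 < ∑_{j=0}^{n-k-1} 1/(1 − x − (j/(n-1))x)^2. -/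
/-- For `n > 2`, `1 ≤ k ≤ n - 2`, and `0 < x < (n-1)/(2n-k-2)`: if
`∑_{i=0}^{n-1} 1/(1 − (i/(n-1))x) = ∑_{j=0}^{n-k-1} 1/(1 − x − (j/(n-1))x)`, then
`∑_{i=0}^{n-1} 1/(1 − (i/(n-1))x)² < ∑_{j=0}^{n-k-1} 1/(1 − x − (j/(n-1))x)²`. -/
theorem sum_sq_lt_of_sum_eq (n k : ℕ) (hn : 2 < n) (hk1 : 1 ≤ k) (hk2 : k ≤ n - 2)
    (x : ℝ) (hx0 : 0 < x) (hx1 : x < ((n : ℝ) - 1) / (2 * (n : ℝ) - (k : ℝ) - 2))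
    (heq : (∑ i ∈ Finset.range n, 1 / (1 - (i / ((n : ℝ) - 1)) * x))
      = ∑ j ∈ Finset.range (n - k), 1 / (1 - x - (j / ((n : ℝ) - 1)) * x)) :
    (∑ i ∈ Finset.range n, 1 / (1 - (i / ((n : ℝ) - 1)) * x) ^ 2)
      < ∑ j ∈ Finset.range (n - k), 1 / (1 - x - (j / ((n : ℝ) - 1)) * x) ^ 2 := by
  have hnR : (2:ℝ) < n := by exact_mod_cast hn
  have hkR : (k:ℝ) + 2 ≤ n := by
    have : k + 2 ≤ n := by omega
    exact_mod_cast this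
  have hk0 : (0:ℝ) ≤ k := Nat.cast_nonneg k
  have hN : (0:ℝ) < (n:ℝ) - 1 := by linarith
  have hD : (0:ℝ) < 2 * (n : ℝ) - (k : ℝ) - 2 := by linarith
  have hx2 : x * (2 * (n : ℝ) - (k : ℝ) - 2) < (n:ℝ) - 1 := (lt_div_iff₀ hD).1 hx1
  have hxlt : x < 1 := by nlinarith
  have h1x : 0 < 1 - x := by linarith
  -- the left terms have denominators at least `1 - x`
  have hA : ∀ i ∈ Finset.range n, 1 - x ≤ 1 - (i / ((n : ℝ) - 1)) * x := by
    intro i hi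
    have hi' : (i:ℝ) + 1 ≤ n := by exact_mod_cast Finset.mem_range.1 hi
    have : (i:ℝ) / ((n : ℝ) - 1) ≤ 1 := (div_le_one hN).2 (by linarith)
    nlinarith
  -- the right terms have positive denominators, at most `1 - x`
  have hB : ∀ j ∈ Finset.range (n - k), 0 < 1 - x - (j / ((n : ℝ) - 1)) * x ∧
      1 - x - (j / ((n : ℝ) - 1)) * x ≤ 1 - x := by
    intro j hj
    have hj' : (j:ℝ) + 1 + k ≤ n := by
      have := Finset.mem_range.1 hj
      have : j + 1 + k ≤ n := by omega
      exact_mod_cast this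
    have hj0 : (0:ℝ) ≤ (j:ℝ) / ((n : ℝ) - 1) := by positivity
    constructor
    · have e : 1 - x - (j / ((n : ℝ) - 1)) * x
          = (((n:ℝ) - 1) - x * ((n:ℝ) - 1 + j)) / ((n:ℝ) - 1) := by
        field_simp
        ring
      rw [e]
      apply div_pos _ hN
      nlinarith
    · nlinarith
  have hL : (∑ i ∈ Finset.range n, 1 / (1 - (i / ((n : ℝ) - 1)) * x) ^ 2)
      < ∑ i ∈ Finset.range n, 1 / (1 - x) * (1 / (1 - (i / ((n : ℝ) - 1)) * x)) := by
    apply Finset.sum_lt_sum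
    · intro i hi
      have h := hA i hi
      have hp := h1x.trans_le h
      rw [sq, ← one_div_mul_one_div]
      exact mul_le_mul_of_nonneg_right (one_div_le_one_div_of_le h1x h) (by positivity)
    · refine ⟨0, Finset.mem_range.2 (by omega), ?_⟩
      have : 1 < 1 / (1 - x) := (one_lt_div h1x).2 (by linarith)
      simpa using this
  have hR : (∑ j ∈ Finset.range (n - k), 1 / (1 - x) * (1 / (1 - x - (j / ((n : ℝ) - 1)) * x)))
      ≤ ∑ j ∈ Finset.range (n - k), 1 / (1 - x - (j / ((n : ℝ) - 1)) * x) ^ 2 := by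
    apply Finset.sum_le_sum
    intro j hj
    obtain ⟨hp, h⟩ := hB j hj
    rw [sq, ← one_div_mul_one_div]
    exact mul_le_mul_of_nonneg_right (one_div_le_one_div_of_le hp h) (by positivity)
  rw [← Finset.mul_sum] at hL hR
  rw [heq] at hL
  exact hL.trans_le hR
end

section
/- Let n > 2 be an integer, k ∈ {1, ..., n-2}, and x ∈ (0, (n-1)/(2n-k-2)). Then φ_{n,k}(x) ≥ (1/2)·(1 − 1/(1 − x − ((n-k-1)/(n-1))x)) − ( 1/(1 − x − ((n-k-1)/(n-1))x)^2 − 1/(1−x)^2 )·x/(4(n-1)) + ((n-1)/x)·ln( (1 − x − ((n-k-1)/(n-1))x) / (1−x)^2 ). -/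
lemma step_lower (u v : ℝ) (hv : 0 < v) (huv : v < u) :
    Real.log u - Real.log v ≤ (u - v) / 2 * (1 / u + 1 / v) := by
  have hu : 0 < u := hv.trans huv
  rw [← Real.log_div hu.ne' hv.ne']
  have h1 : 0 ≤ Real.log (u / v) := Real.log_nonneg (by rw [le_div_iff₀ hv]; linarith)
  have h2 := Real.self_le_sinh_iff.2 h1
  rw [Real.sinh_log (by positivity)] at h2
  refine h2.trans (le_of_eq ?_)
  field_simp
  ring

lemma step_upper (u v : ℝ) (hv : 0 < v) (huv : v < u) :
    (u - v) / 2 * (1 / u + 1 / v) ≤ Real.log u - Real.log v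
      + (u - v) ^ 2 / 4 * (1 / v ^ 2 - 1 / u ^ 2) := by
  have hu : 0 < u := hv.trans huv
  rw [← Real.log_div hu.ne' hv.ne']
  have hd : 0 < u - v := sub_pos.2 huv
  have h1 := Real.le_log_one_add_of_nonneg (x := (u - v) / v) (by positivity)
  have e : 1 + (u - v) / v = u / v := by field_simp; ring
  have e2 : 2 * ((u - v) / v) / ((u - v) / v + 2) = 2 * (u - v) / (u + v) := by
    have : (u - v) / v + 2 = (u + v) / v := by field_simp; ring
    rw [this]; field_simp
  rw [e, e2] at h1
  have key : 2 * (u - v) / (u + v) + (u - v) ^ 2 / 4 * (1 / v ^ 2 - 1 / u ^ 2)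
      - (u - v) / 2 * (1 / u + 1 / v)
      = (u - v) ^ 3 * (u ^ 2 + v ^ 2) / (4 * u ^ 2 * v ^ 2 * (u + v)) := by
    field_simp
    ring
  have : 0 ≤ (u - v) ^ 3 * (u ^ 2 + v ^ 2) / (4 * u ^ 2 * v ^ 2 * (u + v)) := by positivity
  linarith

lemma sum_bounds (u h : ℝ) (hh : 0 < h) (m : ℕ) (hm : m * h < u) :
    Real.log u - Real.log (u - m * h) + h / 2 * (1 / u + 1 / (u - m * h))
        ≤ h * ∑ i ∈ Finset.range (m + 1), 1 / (u - i * h) ∧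
    h * ∑ i ∈ Finset.range (m + 1), 1 / (u - i * h) ≤
      Real.log u - Real.log (u - m * h) + h / 2 * (1 / u + 1 / (u - m * h))
        + h ^ 2 / 4 * (1 / (u - m * h) ^ 2 - 1 / u ^ 2) := by
  induction m with
  | zero => constructor <;> simp <;> apply le_of_eq <;> ring
  | succ m ih =>
    push_cast at hm
    obtain ⟨a, b⟩ := ih (by nlinarith)
    rw [Finset.sum_range_succ, mul_add]
    push_cast
    have p := step_lower (u - m * h) (u - (m + 1) * h) (by linarith) (by nlinarith)
    have q := step_upper (u - m * h) (u - (m + 1) * h) (by linarith) (by nlinarith)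
    rw [show u - m * h - (u - (m + 1) * h) = h by ring] at p q
    constructor <;> linarith

/-- Lower bound for `φ_{n,k}(x)` for `n > 2`, `1 ≤ k ≤ n - 2`, and
`0 < x < (n-1)/(2n-k-2)`. -/
theorem phi_lower_bound (n k : ℕ) (hn : 2 < n) (hk1 : 1 ≤ k) (hk2 : k ≤ n - 2)
    (x : ℝ) (hx0 : 0 < x) (hx1 : x < ((n : ℝ) - 1) / (2 * (n : ℝ) - (k : ℝ) - 2)) :
    (1 / 2) * (1 - 1 / (1 - x - (((n : ℝ) - (k : ℝ) - 1) / ((n : ℝ) - 1)) * x))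
        - (1 / (1 - x - (((n : ℝ) - (k : ℝ) - 1) / ((n : ℝ) - 1)) * x) ^ 2
            - 1 / (1 - x) ^ 2) * x / (4 * ((n : ℝ) - 1))
        + (((n : ℝ) - 1) / x) *
            Real.log ((1 - x - (((n : ℝ) - (k : ℝ) - 1) / ((n : ℝ) - 1)) * x)
              / (1 - x) ^ 2)
      ≤ phi n k x := by
  obtain ⟨m, rfl⟩ : ∃ m, n = m + k + 1 := ⟨n - k - 1, by omega⟩
  have hm : 1 ≤ m := by omega
  have hmR : (1 : ℝ) ≤ m := by exact_mod_cast hm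
  have hkR : (1 : ℝ) ≤ k := by exact_mod_cast hk1
  unfold phi
  rw [show m + k + 1 - k = m + 1 by omega]
  push_cast at hx1 ⊢
  have hN : (0 : ℝ) < m + k := by linarith
  rw [show (m : ℝ) + k + 1 - 1 = m + k by ring] at *
  rw [show (m : ℝ) + k + 1 - k - 1 = m by ring]
  rw [lt_div_iff₀ (by linarith)] at hx1
  obtain ⟨h, rfl⟩ : ∃ h, x = (m + k) * h := ⟨x / (m + k), by field_simp⟩
  have hh : 0 < h := by
    rcases pos_and_pos_or_neg_and_neg_of_mul_pos hx0 with q | q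
    · exact q.2
    · linarith [q.1]
  have e : ∀ t : ℝ, t / (m + k) * ((m + k) * h) = t * h := fun t => by field_simp
  simp only [e]
  have hc : 0 < 1 - (m + k) * h - m * h := by
    by_contra hneg
    push Not at hneg
    nlinarith
  have hmh : 0 < m * h := by positivity
  have A := (sum_bounds 1 h hh (m + k) (by push_cast; linarith)).1
  have B := (sum_bounds (1 - (m + k) * h) h hh m (by linarith)).2
  push_cast at A
  rw [Real.log_one] at A
  have hd : 0 < 1 - (m + k) * h := by linarith
  rw [Real.log_div hc.ne' (by positivity), Real.log_pow]
  rw [← mul_le_mul_iff_right₀ hh]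
  have e1 : ((m : ℝ) + k) / ((m + k) * h) = 1 / h := by field_simp
  have e2 : ∀ t : ℝ, t * ((m + k) * h) / (4 * (m + k)) = t * h / 4 := fun t => by field_simp
  rw [e1, e2]
  have e3 : ∀ t : ℝ, h * (1 / h * t) = t := fun t => by field_simp
  rw [mul_add, e3]
  push_cast
  linarith
end

section
/- Let n > 2 be an integer and k ∈ {1, ..., n-2}. Then φ_{n,k}(k/(n-1)) ≤ k(2n−k−2)(k − 2(n-1)^2)/(4(n-1)^2(n−k−1)^2) < 0. -/
lemma step_upper_s9 (K a : ℝ) (hK : 0 < K) (ha : K < a) :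
    (1 / a + 1 / (a - K)) / 2
      ≤ (Real.log a - Real.log (a - K)) / K + K / 4 * (1 / (a - K) ^ 2 - 1 / a ^ 2) := by
  obtain ⟨b, rfl⟩ : ∃ b, a = b + K := ⟨a - K, by ring⟩
  have hb : 0 < b := by linarith
  have e : b + K - K = b := by ring
  rw [e]
  have h := Real.le_log_one_add_of_nonneg (x := K / b) (by positivity)
  have h1 : 1 + K / b = (b + K) / b := by field_simp
  rw [h1, Real.log_div (by positivity) (by positivity)] at h
  have h2 : 2 / (2 * b + K) ≤ (Real.log (b + K) - Real.log b) / K := by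
    rw [le_div_iff₀ hK]
    refine le_trans (le_of_eq ?_) h
    field_simp
    ring
  have h3 : (1 / (b + K) + 1 / b) / 2
      ≤ 2 / (2 * b + K) + K / 4 * (1 / b ^ 2 - 1 / (b + K) ^ 2) := by
    have : 2 / (2 * b + K) + K / 4 * (1 / b ^ 2 - 1 / (b + K) ^ 2) - (1 / (b + K) + 1 / b) / 2
        = K ^ 2 * (b ^ 2 + (b + K) ^ 2) / (4 * b ^ 2 * (b + K) ^ 2 * (2 * b + K)) := by
      field_simp
      ring
    have h4 : 0 ≤ K ^ 2 * (b ^ 2 + (b + K) ^ 2) / (4 * b ^ 2 * (b + K) ^ 2 * (2 * b + K)) := by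
      positivity
    linarith
  linarith

lemma step_lower_s9 (K a : ℝ) (hK : 0 < K) (ha : K < a) :
    (Real.log a - Real.log (a - K)) / K ≤ (1 / a + 1 / (a - K)) / 2 := by
  obtain ⟨b, rfl⟩ : ∃ b, a = b + K := ⟨a - K, by ring⟩
  have hb : 0 < b := by linarith
  have e : b + K - K = b := by ring
  rw [e, div_le_iff₀ hK, ← Real.log_div (by positivity) (by positivity)]
  have h0 : 0 ≤ Real.log ((b + K) / b) := by
    apply Real.log_nonneg
    rw [le_div_iff₀ hb]; linarith
  have h := Real.self_le_sinh_iff.2 h0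
  rw [Real.sinh_log (by positivity)] at h
  refine h.trans (le_of_eq ?_)
  field_simp
  ring

lemma sum_upper_s9 (K A : ℝ) (hK : 0 < K) (p : ℕ) (hp : (p : ℝ) * K < A) :
    ∑ i ∈ Finset.range p, 1 / (A - i * K)
      ≤ (1 / A - 1 / (A - p * K)) / 2 + (Real.log A - Real.log (A - p * K)) / K
        + K / 4 * (1 / (A - p * K) ^ 2 - 1 / A ^ 2) := by
  induction p with
  | zero => simp
  | succ p ih =>
    push_cast at hp ⊢
    rw [Finset.sum_range_succ]
    have h1 := ih (by linarith)
    have h2 := step_upper_s9 K (A - p * K) hK (by linarith)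
    have e : A - (p + 1) * K = A - p * K - K := by ring
    rw [e]
    simp only [sub_div] at *
    linarith

lemma sum_lower_s9 (K A : ℝ) (hK : 0 < K) (p : ℕ) (hp : (p : ℝ) * K < A) :
    (1 / (A - p * K) - 1 / A) / 2 + (Real.log A - Real.log (A - p * K)) / K
      ≤ ∑ i ∈ Finset.range p, 1 / (A - ((i + 1 : ℕ) : ℝ) * K) := by
  induction p with
  | zero => simp
  | succ p ih =>
    push_cast at hp ih ⊢
    rw [Finset.sum_range_succ]
    have h1 := ih (by linarith)
    have h2 := step_lower_s9 K (A - p * K) hK (by linarith)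
    have e : A - (p + 1) * K = A - p * K - K := by ring
    rw [e]
    simp only [sub_div] at *
    linarith

/-- For `n > 2` and `1 ≤ k ≤ n - 2`,
`φ_{n,k}(k/(n-1)) ≤ k(2n−k−2)(k − 2(n-1)²)/(4(n-1)²(n−k−1)²) < 0`. -/
theorem phi_neg_at_right_endpoint (n k : ℕ) (hn : 2 < n) (hk1 : 1 ≤ k) (hk2 : k ≤ n - 2) :
    phi n k ((k : ℝ) / ((n : ℝ) - 1))
        ≤ (k : ℝ) * (2 * (n : ℝ) - (k : ℝ) - 2) * ((k : ℝ) - 2 * ((n : ℝ) - 1) ^ 2)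
            / (4 * ((n : ℝ) - 1) ^ 2 * ((n : ℝ) - (k : ℝ) - 1) ^ 2) ∧
      (k : ℝ) * (2 * (n : ℝ) - (k : ℝ) - 2) * ((k : ℝ) - 2 * ((n : ℝ) - 1) ^ 2)
          / (4 * ((n : ℝ) - 1) ^ 2 * ((n : ℝ) - (k : ℝ) - 1) ^ 2) < 0 := by
  obtain ⟨d, rfl⟩ : ∃ d, n = k + d + 1 := ⟨n - k - 1, by omega⟩
  have hd : 1 ≤ d := by omega
  have hK : (0 : ℝ) < k := by exact_mod_cast hk1
  have hD : (0 : ℝ) < d := by exact_mod_cast hd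
  have hK1 : (1 : ℝ) ≤ k := by exact_mod_cast hk1
  have hD1 : (1 : ℝ) ≤ d := by exact_mod_cast hd
  have e1 : ((k + d + 1 : ℕ) : ℝ) - 1 = k + d := by push_cast; ring
  have e2 : ((k + d + 1 : ℕ) : ℝ) - k - 1 = d := by push_cast; ring
  have e3 : 2 * ((k + d + 1 : ℕ) : ℝ) - k - 2 = k + 2 * d := by push_cast; ring
  have e4 : k + d + 1 - k = d + 1 := by omega
  rw [phi, e1, e2, e3, e4]
  generalize hM : (k : ℝ) + d = M
  have hMp : 0 < M := by linarith
  have hdM : (d : ℝ) = M - k := by linarith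
  constructor
  · have s1 : ∑ i ∈ Finset.range (k + d + 1), 1 / (1 - ((i : ℝ) / M) * (k / M))
        = M ^ 2 * ∑ i ∈ Finset.range (k + d + 1), 1 / (M ^ 2 - i * k) := by
      rw [Finset.mul_sum]
      refine Finset.sum_congr rfl fun i _ => ?_
      have : 1 - ((i : ℝ) / M) * (k / M) = (M ^ 2 - i * k) / M ^ 2 := by field_simp
      rw [this, one_div_div, mul_one_div]
    have s2 : ∑ i ∈ Finset.range (d + 1), 1 / (1 - (k : ℝ) / M - ((i : ℝ) / M) * (k / M))
        = M ^ 2 * ∑ i ∈ Finset.range (d + 1), 1 / (M * d - i * k) := by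
      rw [Finset.mul_sum]
      refine Finset.sum_congr rfl fun i _ => ?_
      have : 1 - (k : ℝ) / M - ((i : ℝ) / M) * (k / M) = (M * d - i * k) / M ^ 2 := by
        rw [hdM]; field_simp
      rw [this, one_div_div, mul_one_div]
    have c1 : M ^ 2 - ((k + d : ℕ) : ℝ) * k = M * d := by push_cast; rw [hM, hdM]; ring
    have c2 : M * d - (d : ℝ) * k = d ^ 2 := by rw [hdM]; ring
    have u := sum_upper_s9 k (M ^ 2) hK (k + d) (by
      have : 0 < M * d := by positivity
      linarith)
    have l := sum_lower_s9 k (M * d) hK d (by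
      have : (0 : ℝ) < d ^ 2 := by positivity
      linarith)
    rw [c1] at u
    rw [c2] at l
    rw [s1, s2, Finset.sum_range_succ, c1, Finset.sum_range_succ' _ d, ← mul_sub]
    have z : M * (d : ℝ) - ((0 : ℕ) : ℝ) * k = M * d := by simp
    rw [z]
    have lg : Real.log (M ^ 2) - Real.log (M * d) = Real.log (M * d) - Real.log ((d : ℝ) ^ 2) := by
      rw [Real.log_mul hMp.ne' hD.ne', Real.log_pow, Real.log_pow]; push_cast; ring
    rw [lg] at u
    calc _ ≤ M ^ 2 * ((1 / M ^ 2 - 1 / d ^ 2) / 2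
          + k / 4 * (1 / (M * d) ^ 2 - 1 / (M ^ 2) ^ 2)) := by
          refine mul_le_mul_of_nonneg_left ?_ (by positivity)
          linarith
      _ = _ := by
          subst hM
          field_simp
          ring
  · apply div_neg_of_neg_of_pos
    · apply mul_neg_of_pos_of_neg (by positivity)
      nlinarith
    · positivity
end

section
/- Let n > 2 be an integer and k ∈ {2, ..., n-2}. Then φ_{n,k}((k-1)/(n-1)) > 0. -/
lemma aux_step (u v : ℝ) (hu : 0 < u) (hv : 0 < v) :
    Real.log u - Real.log v ≤ (u - v) / v := by
  rw [← Real.log_div hu.ne' hv.ne']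
  have := Real.log_le_sub_one_of_pos (div_pos hu hv)
  rwa [sub_div, div_self hv.ne']

lemma aux_A (s : ℝ) (hs : 0 ≤ s) (a : ℝ) (M : ℕ) (h : 0 < a - M * s) :
    Real.log a - Real.log (a - M * s) ≤ ∑ i ∈ Finset.range M, s / (a - ((i + 1 : ℕ) : ℝ) * s) := by
  induction M with
  | zero => simp
  | succ m ih =>
    rw [Finset.sum_range_succ]
    have h2 : 0 < a - m * s := by push_cast at h; nlinarith
    have := aux_step (a - m * s) (a - ((m + 1 : ℕ) : ℝ) * s) h2 h
    rw [show a - m * s - (a - ((m + 1 : ℕ) : ℝ) * s) = s by push_cast; ring] at this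
    linarith [ih h2]

lemma aux_B (s : ℝ) (hs : 0 ≤ s) (a : ℝ) (M : ℕ) (h : 0 < a - M * s) :
    ∑ i ∈ Finset.range M, s / (a - (i : ℝ) * s) ≤ Real.log a - Real.log (a - M * s) := by
  induction M with
  | zero => simp
  | succ m ih =>
    rw [Finset.sum_range_succ]
    have h2 : 0 < a - m * s := by push_cast at h; nlinarith
    have := aux_step (a - ((m + 1 : ℕ) : ℝ) * s) (a - m * s) h h2
    rw [show a - ((m + 1 : ℕ) : ℝ) * s - (a - m * s) = -s by push_cast; ring, neg_div] at this
    linarith [ih h2]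

/-- For `n > 2` and `2 ≤ k ≤ n - 2`, `φ_{n,k}((k-1)/(n-1)) > 0`. -/
theorem phi_pos_at_left_endpoint (n k : ℕ) (hn : 2 < n) (hk1 : 2 ≤ k) (hk2 : k ≤ n - 2) :
    0 < phi n k (((k : ℝ) - 1) / ((n : ℝ) - 1)) := by
  obtain ⟨j, rfl⟩ : ∃ j, k = j + 1 := ⟨k - 1, by omega⟩
  obtain ⟨N, rfl⟩ : ∃ N, n = N + 1 := ⟨n - 1, by omega⟩
  have hjN : j < N := by omega
  have hj : (0 : ℝ) < j := by exact_mod_cast (by omega : 0 < j)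
  have hN : (0 : ℝ) < N := by exact_mod_cast (by omega : 0 < N)
  have hjN' : (j : ℝ) < N := by exact_mod_cast hjN
  unfold phi
  rw [show N + 1 - (j + 1) = N - j by omega,
    show ((N + 1 : ℕ) : ℝ) - 1 = N by push_cast; ring,
    show ((j + 1 : ℕ) : ℝ) - 1 = j by push_cast; ring]
  obtain ⟨x, hx⟩ : ∃ x : ℝ, x = j / N := ⟨_, rfl⟩
  obtain ⟨s, hs⟩ : ∃ s : ℝ, s = x / N := ⟨_, rfl⟩
  rw [← hx]
  have hx0 : 0 < x := by rw [hx]; positivity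
  have hx1 : x < 1 := by rw [hx, div_lt_one hN]; exact hjN'
  have hs0 : 0 < s := by rw [hs]; positivity
  have hNs : N * s = x := by rw [hs]; field_simp
  have e2 : 1 - x - ((N - j : ℕ) : ℝ) * s = (1 - x) ^ 2 := by
    rw [Nat.cast_sub hjN.le, hs, hx]; field_simp
  have A := aux_A s hs0.le 1 N (by rw [hNs]; linarith)
  have B := aux_B s hs0.le (1 - x) (N - j) (by rw [e2]; have : 0 < 1 - x := by linarith
                                               positivity)
  rw [e2, Real.log_pow] at B
  rw [hNs, Real.log_one] at A
  have hc : ∀ i : ℕ, (i : ℝ) / N * x = i * s := fun i => by rw [hs]; ring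
  simp only [hc]
  rw [Finset.sum_range_succ']
  simp only [div_eq_mul_inv s, ← Finset.mul_sum] at A B
  simp only [one_div]
  push_cast at A B ⊢
  have := (mul_le_mul_iff_right₀ hs0).1 (B.trans (le_trans (by linarith) A))
  norm_num
  linarith
end

section
/- For every integer m ≥ 1, with n = 2m and k = m, one has φ_{2m,m}(1/2) > 0. -/
lemma sum_pairs_aux (f : ℕ → ℝ) (m : ℕ) :
    ∑ i ∈ Finset.range (2 * m), f i = ∑ t ∈ Finset.range m, (f (2 * t) + f (2 * t + 1)) := by
  induction m with
  | zero => simp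
  | succ k ih =>
    rw [show 2 * (k + 1) = 2 * k + 1 + 1 by ring, Finset.sum_range_succ, Finset.sum_range_succ,
      Finset.sum_range_succ, ih]
    ring

/-- For every integer `m ≥ 1`, `φ_{2m,m}(1/2) > 0`. -/
theorem phi_pos_at_half (m : ℕ) (hm : 1 ≤ m) :
    0 < phi (2 * m) m (1 / 2) := by
  unfold phi
  rw [sum_pairs_aux, show 2 * m - m = m by omega, sub_pos]
  apply Finset.sum_lt_sum_of_nonempty
  · exact Finset.nonempty_range_iff.mpr (by omega)
  intro t ht
  have ht' : t + 1 ≤ m := Finset.mem_range.mp ht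
  have h1 : (t : ℝ) + 1 ≤ m := by exact_mod_cast ht'
  have hm' : (1 : ℝ) ≤ m := by exact_mod_cast hm
  have ht0 : (0 : ℝ) ≤ t := Nat.cast_nonneg t
  push_cast
  set N : ℝ := 2 * (m : ℝ) - 1 with hN
  have hNpos : 0 < N := by linarith
  have hd : 0 < N - t := by linarith
  have hd2 : 0 < 2 * N - 2 * t - 1 := by linarith
  have e1 : 1 / (1 - 1 / 2 - (t : ℝ) / N * (1 / 2)) = 2 * N / (N - t) := by
    rw [show 1 - 1 / 2 - (t : ℝ) / N * (1 / 2) = (N - t) / (2 * N) by field_simp; ring, one_div_div]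
  have e2 : 1 / (1 - (2 * (t : ℝ)) / N * (1 / 2)) = N / (N - t) := by
    rw [show 1 - (2 * (t : ℝ)) / N * (1 / 2) = (N - t) / N by field_simp, one_div_div]
  have e3 : 1 / (1 - (2 * (t : ℝ) + 1) / N * (1 / 2)) = 2 * N / (2 * N - 2 * t - 1) := by
    rw [show 1 - (2 * (t : ℝ) + 1) / N * (1 / 2) = (2 * N - 2 * t - 1) / (2 * N) by
      field_simp; ring, one_div_div]
  rw [e1, e2, e3]
  have e4 : 2 * N / (N - t) = N / (N - t) + 2 * N / (2 * N - 2 * t) := by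
    rw [show 2 * N - 2 * (t : ℝ) = 2 * (N - t) by ring]
    field_simp; ring
  rw [e4]
  have : 2 * N / (2 * N - 2 * t) < 2 * N / (2 * N - 2 * t - 1) :=
    div_lt_div_of_pos_left (by linarith) hd2 (by linarith)
  linarith
end

section
/- For any integer n ≥ 2, the function x ↦ p_{n,0}(x) is monotone decreasing on [0,1], and the function x ↦ p_{n,n}(x) is monotone increasing on [0,1]. -/
/-- Rising factorial with increment `h`: `t^{(j,h)} = ∏_{i=0}^{j-1} (t + i·h)`. -/
def risingFac (t h : ℝ) (j : ℕ) : ℝ :=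
  ∏ i ∈ Finset.range j, (t + i * h)

/-- The Pólya urn probabilities with minimal negative replacement
`c(x) = −min(x, 1−x)/(n−1)`:
`p_{n,k}(x) = C(n,k)·x^{(k,c(x))}·(1−x)^{(n−k,c(x))}/1^{(n,c(x))}`. -/
noncomputable def polyaP (n k : ℕ) (x : ℝ) : ℝ :=
  (n.choose k : ℝ)
    * risingFac x (-min x (1 - x) / ((n : ℝ) - 1)) k
    * risingFac (1 - x) (-min x (1 - x) / ((n : ℝ) - 1)) (n - k)
    / risingFac 1 (-min x (1 - x) / ((n : ℝ) - 1)) n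

theorem polyaP_zero_eq (n : ℕ) (x : ℝ) :
    polyaP n 0 x = ∏ i ∈ Finset.range n,
      ((1 - x + i * (-min x (1 - x) / ((n : ℝ) - 1))) /
        (1 + i * (-min x (1 - x) / ((n : ℝ) - 1)))) := by
  simp [polyaP, risingFac, Finset.prod_div_distrib]

theorem polyaP_symm (n : ℕ) (x : ℝ) : polyaP n n x = polyaP n 0 (1 - x) := by
  simp [polyaP, risingFac, min_comm]

theorem polyaP_high (n : ℕ) (hn : 2 ≤ n) (x : ℝ) (hx : 1 / 2 ≤ x) : polyaP n 0 x = 0 := by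
  rw [polyaP_zero_eq]
  apply Finset.prod_eq_zero (i := n - 1) (Finset.mem_range.2 (by omega))
  rw [min_eq_right (by linarith)]
  have h : (n : ℝ) - 1 ≠ 0 := by
    have : (2 : ℝ) ≤ n := by exact_mod_cast hn
    linarith
  rw [Nat.cast_sub (by omega)]
  rw [div_eq_zero_iff]
  left
  push_cast
  field_simp
  ring

theorem polyaP_low (n : ℕ) (x : ℝ) (hx : x ≤ 1 / 2) :
    polyaP n 0 x = ∏ i ∈ Finset.range n,
      ((1 - x - (i / ((n : ℝ) - 1)) * x) / (1 - (i / ((n : ℝ) - 1)) * x)) := by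
  rw [polyaP_zero_eq, min_eq_left (by linarith)]
  refine Finset.prod_congr rfl fun i _ => ?_
  congr 1 <;> ring

theorem ratio_bounds (n : ℕ) (hn : 2 ≤ n) (i : ℕ) (hi : i ∈ Finset.range n) :
    0 ≤ (i : ℝ) / ((n : ℝ) - 1) ∧ (i : ℝ) / ((n : ℝ) - 1) ≤ 1 := by
  have h2 : (2 : ℝ) ≤ n := by exact_mod_cast hn
  have h3 : (i : ℝ) + 1 ≤ n := by exact_mod_cast Finset.mem_range.1 hi
  have h : 0 < (n : ℝ) - 1 := by linarith
  exact ⟨by positivity, by rw [div_le_one h]; linarith⟩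

theorem factor_nonneg (r x : ℝ) (h0 : 0 ≤ r) (h1 : r ≤ 1) (hx0 : 0 ≤ x) (hx : x ≤ 1 / 2) :
    0 ≤ (1 - x - r * x) / (1 - r * x) := by
  have : r * x ≤ x := by nlinarith
  exact div_nonneg (by linarith) (by linarith)

theorem polyaP_zero_anti (n : ℕ) (hn : 2 ≤ n) (x y : ℝ) (hx0 : 0 ≤ x) (hxy : x ≤ y) :
    polyaP n 0 y ≤ polyaP n 0 x := by
  rcases le_total (1 / 2) x with h | hx
  · rw [polyaP_high n hn x h, polyaP_high n hn y (h.trans hxy)]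
  rcases le_total (1 / 2) y with h | hy
  · rw [polyaP_high n hn y h, polyaP_low n x hx]
    refine Finset.prod_nonneg fun i hi => ?_
    obtain ⟨h0, h1⟩ := ratio_bounds n hn i hi
    exact factor_nonneg _ x h0 h1 hx0 hx
  · rw [polyaP_low n x hx, polyaP_low n y hy]
    refine Finset.prod_le_prod (fun i hi => ?_) (fun i hi => ?_)
    · obtain ⟨h0, h1⟩ := ratio_bounds n hn i hi
      exact factor_nonneg _ y h0 h1 (hx0.trans hxy) hy
    · obtain ⟨h0, h1⟩ := ratio_bounds n hn i hi
      generalize (i : ℝ) / ((n : ℝ) - 1) = r at h0 h1 ⊢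
      have a : r * x ≤ x := by nlinarith
      have b : r * y ≤ y := by nlinarith
      rw [div_le_div_iff₀ (by linarith) (by linarith)]
      nlinarith

/-- For `n ≥ 2`, `x ↦ p_{n,0}(x)` is monotone decreasing on `[0,1]` and
`x ↦ p_{n,n}(x)` is monotone increasing on `[0,1]`. -/
theorem polyaP_endpoint_monotone (n : ℕ) (hn : 2 ≤ n) :
    AntitoneOn (fun x => polyaP n 0 x) (Set.Icc 0 1) ∧
    MonotoneOn (fun x => polyaP n n x) (Set.Icc 0 1) := by
  constructor
  · intro x hx y _ hxy
    exact polyaP_zero_anti n hn x y hx.1 hxy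
  · intro x _ y hy hxy
    simp only [polyaP_symm n]
    exact polyaP_zero_anti n hn (1 - y) (1 - x) (by linarith [hy.2]) (by linarith)
end

section
/- Let n ≥ 2 be an integer. For every k ∈ {0, 1, ..., n} and all 0 ≤ x ≤ y ≤ 1, one has ∑_{i=0}^{k} p_{n,i}(x) ≥ ∑_{i=0}^{k} p_{n,i}(y). Consequently, for every monotone increasing function f : [0,1] → ℝ, the function R_n(f, ·) : [0,1] → ℝ defined by R_n(f, x) = ∑_{k=0}^{n} f(k/n) · p_{n,k}(x) is monotone increasing on [0,1]. -/
lemma risingFac_succ (t h : ℝ) (j : ℕ) :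
    risingFac t h (j + 1) = risingFac t h j * (t + j * h) := by
  simp [risingFac, Finset.prod_range_succ]

/-- Vandermonde identity for rising factorials. -/
lemma risingFac_vandermonde (x y h : ℝ) (n : ℕ) :
    ∑ p ∈ Finset.HasAntidiagonal.antidiagonal n, (n.choose p.1 : ℝ) * (risingFac x h p.1 * risingFac y h p.2)
      = risingFac (x + y) h n := by
  induction n with
  | zero => simp [risingFac]
  | succ n ih =>
    rw [Finset.sum_antidiagonal_choose_succ_mul (fun i j => risingFac x h i * risingFac y h j) n,
      risingFac_succ, ← ih, Finset.sum_mul, ← Finset.sum_add_distrib]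
    refine Finset.sum_congr rfl fun p hp => ?_
    have hp' := Finset.HasAntidiagonal.mem_antidiagonal.1 hp
    have hc : n.choose p.2 = n.choose p.1 := by
      rw [← hp']; exact (Nat.choose_symm_add).symm
    rw [hc, risingFac_succ, risingFac_succ, ← hp']
    push_cast
    ring

/-- The increment `c(x)`. -/
noncomputable def incr (n : ℕ) (x : ℝ) : ℝ := -min x (1 - x) / ((n : ℝ) - 1)

lemma ratio_mem (n : ℕ) (hn : 2 ≤ n) (i : ℕ) (hi : i < n) :
    0 ≤ (i : ℝ) / ((n : ℝ) - 1) ∧ (i : ℝ) / ((n : ℝ) - 1) ≤ 1 := by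
  have h2 : (2 : ℝ) ≤ n := by exact_mod_cast hn
  have h1 : (0 : ℝ) < (n : ℝ) - 1 := by linarith
  have h3 : (i : ℝ) + 1 ≤ n := by exact_mod_cast hi
  exact ⟨by positivity, by rw [div_le_one h1]; linarith⟩

lemma mul_incr (n i : ℕ) (x : ℝ) :
    (i : ℝ) * incr n x = -((i : ℝ) / ((n : ℝ) - 1)) * min x (1 - x) := by
  unfold incr; ring

lemma aux_mono (t x y : ℝ) (h0 : 0 ≤ t) (h1 : t ≤ 1) (hxy : x ≤ y) :
    x - t * min x (1 - x) ≤ y - t * min y (1 - y) := by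
  rcases le_total x (1 - x) with hx | hx <;> rcases le_total y (1 - y) with hy | hy <;>
    simp only [min_eq_left, min_eq_right, hx, hy] <;> nlinarith

lemma aux_nonneg (t x : ℝ) (h0 : 0 ≤ t) (h1 : t ≤ 1) (hx : 0 ≤ x) :
    0 ≤ x - t * min x (1 - x) := by
  have := min_le_left x (1 - x)
  nlinarith

lemma a_mono (n : ℕ) (hn : 2 ≤ n) (i : ℕ) (hi : i < n) {x y : ℝ} (hxy : x ≤ y) :
    x + i * incr n x ≤ y + i * incr n y := by
  obtain ⟨h0, h1⟩ := ratio_mem n hn i hi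
  rw [mul_incr, mul_incr]
  linarith [aux_mono _ x y h0 h1 hxy]

lemma a_nonneg (n : ℕ) (hn : 2 ≤ n) (i : ℕ) (hi : i < n) {x : ℝ} (hx : 0 ≤ x) :
    0 ≤ x + i * incr n x := by
  obtain ⟨h0, h1⟩ := ratio_mem n hn i hi
  rw [mul_incr]
  linarith [aux_nonneg _ x h0 h1 hx]

lemma incr_symm (n : ℕ) (x : ℝ) : incr n (1 - x) = incr n x := by
  unfold incr; rw [min_comm]; simp

lemma Z_pos (n : ℕ) (hn : 2 ≤ n) (x : ℝ) : 0 < risingFac 1 (incr n x) n := by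
  refine Finset.prod_pos fun i hi => ?_
  obtain ⟨h0, h1⟩ := ratio_mem n hn i (Finset.mem_range.1 hi)
  rw [mul_incr]
  have : min x (1 - x) ≤ 1 / 2 := by
    rcases le_total x (1 - x) with h | h
    · rw [min_eq_left h]; linarith
    · rw [min_eq_right h]; linarith
  nlinarith

lemma polyaP_eq (n k : ℕ) (x : ℝ) : polyaP n k x = (n.choose k : ℝ)
    * risingFac x (incr n x) k * risingFac (1 - x) (incr n x) (n - k)
    / risingFac 1 (incr n x) n := rfl

lemma polyaP_sum (n : ℕ) (hn : 2 ≤ n) (x : ℝ) :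
    ∑ k ∈ Finset.range (n + 1), polyaP n k x = 1 := by
  have hv := risingFac_vandermonde x (1 - x) (incr n x) n
  rw [Finset.Nat.sum_antidiagonal_eq_sum_range_succ_mk, add_sub_cancel] at hv
  simp only [polyaP_eq]
  rw [← Finset.sum_div, div_eq_one_iff_eq (Z_pos n hn x).ne', ← hv]
  exact Finset.sum_congr rfl fun k _ => by ring

lemma rf_split (t h : ℝ) {k j : ℕ} (hkj : k ≤ j) :
    risingFac t h j = risingFac t h k * ∏ i ∈ Finset.Ico k j, (t + i * h) := by
  unfold risingFac
  rw [Finset.prod_range_mul_prod_Ico _ hkj]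

lemma rf_nonneg (n : ℕ) (hn : 2 ≤ n) (k : ℕ) (hk : k ≤ n) {x : ℝ} (hx : 0 ≤ x) :
    0 ≤ risingFac x (incr n x) k :=
  Finset.prod_nonneg fun i hi => a_nonneg n hn i (by have := Finset.mem_range.1 hi; omega) hx

/-- cross inequality for rising factorials -/
lemma rf_cross (n : ℕ) (hn : 2 ≤ n) {k j : ℕ} (hkj : k ≤ j) (hj : j ≤ n) {x y : ℝ}
    (hx : 0 ≤ x) (hxy : x ≤ y) :
    risingFac x (incr n x) j * risingFac y (incr n y) k
      ≤ risingFac x (incr n x) k * risingFac y (incr n y) j := by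
  rw [rf_split x _ hkj, rf_split y _ hkj]
  have h : ∏ i ∈ Finset.Ico k j, (x + i * incr n x) ≤ ∏ i ∈ Finset.Ico k j, (y + i * incr n y) := by
    refine Finset.prod_le_prod (fun i hi => ?_) (fun i hi => ?_)
    · exact a_nonneg n hn i (by have := Finset.mem_Ico.1 hi; omega) hx
    · exact a_mono n hn i (by have := Finset.mem_Ico.1 hi; omega) hxy
  have := mul_le_mul_of_nonneg_left h (mul_nonneg (rf_nonneg n hn k (hkj.trans hj) hx)
    (rf_nonneg n hn k (hkj.trans hj) (hx.trans hxy)))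
  linarith

/-- monotone likelihood ratio -/
lemma polyaP_mlr (n : ℕ) (hn : 2 ≤ n) {k j : ℕ} (hkj : k ≤ j) (hj : j ≤ n) {x y : ℝ}
    (hx : 0 ≤ x) (hxy : x ≤ y) (hy : y ≤ 1) :
    polyaP n j x * polyaP n k y ≤ polyaP n k x * polyaP n j y := by
  have h1 := rf_cross n hn hkj hj hx hxy
  have h2 := rf_cross n hn (show n - j ≤ n - k by omega) (Nat.sub_le n k)
    (show 0 ≤ 1 - y by linarith) (show 1 - y ≤ 1 - x by linarith)
  simp only [incr_symm] at h2
  have n1 := rf_nonneg n hn (n - k) (Nat.sub_le n k) (show 0 ≤ 1 - y by linarith)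
  have n2 := rf_nonneg n hn (n - j) (Nat.sub_le n j) (show 0 ≤ 1 - x by linarith)
  have n3 := rf_nonneg n hn k (hkj.trans hj) hx
  have n4 := rf_nonneg n hn j hj (hx.trans hxy)
  rw [incr_symm] at n1 n2
  have h3 := mul_le_mul h1 h2 (mul_nonneg n1 n2) (mul_nonneg n3 n4)
  simp only [polyaP_eq]
  rw [div_mul_div_comm, div_mul_div_comm]
  refine div_le_div_of_nonneg_right ?_ (mul_pos (Z_pos n hn x) (Z_pos n hn y)).le
  have h4 := mul_le_mul_of_nonneg_left h3
    (show (0 : ℝ) ≤ (n.choose k : ℝ) * (n.choose j : ℝ) by positivity)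
  linarith

lemma polyaP_order (n : ℕ) (hn : 2 ≤ n) (k : ℕ) (hk : k ≤ n) {x y : ℝ}
    (hx : 0 ≤ x) (hxy : x ≤ y) (hy : y ≤ 1) :
    ∑ i ∈ Finset.range (k + 1), polyaP n i y ≤ ∑ i ∈ Finset.range (k + 1), polyaP n i x := by
  have sx := polyaP_sum n hn x
  have sy := polyaP_sum n hn y
  rw [← Finset.sum_range_add_sum_Ico _ (show k + 1 ≤ n + 1 by omega)] at sx sy
  have key : (∑ j ∈ Finset.Ico (k + 1) (n + 1), polyaP n j x)
        * (∑ i ∈ Finset.range (k + 1), polyaP n i y)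
      ≤ (∑ j ∈ Finset.Ico (k + 1) (n + 1), polyaP n j y)
        * (∑ i ∈ Finset.range (k + 1), polyaP n i x) := by
    rw [Finset.sum_mul_sum, Finset.sum_mul_sum]
    refine Finset.sum_le_sum fun j hj => Finset.sum_le_sum fun i hi => ?_
    have hj' := Finset.mem_Ico.1 hj
    have hi' := Finset.mem_range.1 hi
    have := polyaP_mlr n hn (show i ≤ j by omega) (show j ≤ n by omega) hx hxy hy
    linarith
  rw [← eq_sub_iff_add_eq'] at sx sy
  rw [sx, sy] at key
  linarith

lemma abel_sum (g p : ℕ → ℝ) (n : ℕ) :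
    ∑ k ∈ Finset.range (n + 1), g k * p k = g n * ∑ k ∈ Finset.range (n + 1), p k
      - ∑ k ∈ Finset.range n, (g (k + 1) - g k) * ∑ i ∈ Finset.range (k + 1), p i := by
  induction n with
  | zero => simp
  | succ n ih =>
    rw [Finset.sum_range_succ, ih, Finset.sum_range_succ p (n + 1),
      Finset.sum_range_succ (fun k => (g (k + 1) - g k) * ∑ i ∈ Finset.range (k + 1), p i) n]
    ring

/-- Theorems 2 and 3 of the paper: for `n ≥ 2`, the Pólya urn distribution
functions are decreasing in `x`, and `R_n` preserves monotonicity. -/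
theorem polyaP_stochastic_order_and_Rn_monotone (n : ℕ) (hn : 2 ≤ n) :
    (∀ k ≤ n, ∀ x y : ℝ, 0 ≤ x → x ≤ y → y ≤ 1 →
      ∑ i ∈ Finset.range (k + 1), polyaP n i y
        ≤ ∑ i ∈ Finset.range (k + 1), polyaP n i x) ∧
    (∀ f : ℝ → ℝ, MonotoneOn f (Set.Icc 0 1) →
      MonotoneOn (fun x => ∑ k ∈ Finset.range (n + 1), f ((k : ℝ) / n) * polyaP n k x)
        (Set.Icc 0 1)) := by
  refine ⟨fun k hk x y hx hxy hy => polyaP_order n hn k hk hx hxy hy, ?_⟩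
  intro f hf x hx y hy hxy
  have hn0 : (0 : ℝ) < n := by exact_mod_cast (by omega : 0 < n)
  have mem : ∀ k : ℕ, k ≤ n → (k : ℝ) / n ∈ Set.Icc (0 : ℝ) 1 := fun k hk =>
    ⟨by positivity, by rw [div_le_one hn0]; exact_mod_cast hk⟩
  simp only
  rw [abel_sum (fun k => f ((k : ℝ) / n)) (fun k => polyaP n k x),
    abel_sum (fun k => f ((k : ℝ) / n)) (fun k => polyaP n k y),
    polyaP_sum n hn, polyaP_sum n hn]
  refine sub_le_sub_left (Finset.sum_le_sum fun k hk => ?_) _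
  have hk' := Finset.mem_range.1 hk
  refine mul_le_mul_of_nonneg_left (polyaP_order n hn k hk'.le hx.1 hxy hy.2) ?_
  refine sub_nonneg.2 (hf (mem k hk'.le) (mem (k + 1) hk') ?_)
  push_cast
  gcongr
  linarith
end
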